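/- Write G(t,τ) = ĝ_τ(t), viewed as a function of the two real variables t and τ ≥ 0. Then for all real t and all τ ≥ 0, the sum of the first partial derivatives satisfies ∂G/∂t (t,τ) + ∂G/∂τ (t,τ) = (2/π) ∫_{π(t+τ)}^{π(t+τ+1)} (sin²u)/u² du. -/

import Mathlib

open MeasureTheory Real Set FourierTransform Filter Topology

/-- The auxiliary function `g_τ`, supported on `[-1,1]`, with
`g_τ(x) = 2(1-|x|)(cos(2πτx) - cos(2π(τ+1)x))/(4π²x²)` for `0 < |x| ≤ 1` and the
continuous extension `g_τ(0) = 2τ + 1`. -/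
noncomputable def gfun (τ : ℝ) (x : ℝ) : ℝ :=
  if x = 0 then 2 * τ + 1
  else if |x| ≤ 1 then
    2 * (1 - |x|) * (Real.cos (2 * π * τ * x) - Real.cos (2 * π * (τ + 1) * x)) /
      (4 * π ^ 2 * x ^ 2)
  else 0

/-- The Fourier transform `ĝ_τ(t) = ∫_{-1}^{1} g_τ(x) e^{-2πixt} dx`.  Since `g_τ` is
real-valued, even and supported in `[-1,1]`, this equals the real-valued cosine
integral `∫ g_τ(x) cos(2πxt) dx` over `ℝ`, which we take as the definition. -/
noncomputable def ghat (τ : ℝ) (t : ℝ) : ℝ :=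
  ∫ x : ℝ, gfun τ x * Real.cos (2 * π * x * t)

/-- The triangular kernel `max (1 - |x|) 0`. -/
noncomputable def tent (x : ℝ) : ℝ := max (1 - |x|) 0

lemma tent_nonneg (x : ℝ) : 0 ≤ tent x := le_max_right _ _

lemma continuous_tent : Continuous tent := by
  unfold tent; fun_prop

lemma tent_of_one_le_abs {x : ℝ} (hx : 1 ≤ |x|) : tent x = 0 :=
  max_eq_right (by linarith)

lemma tent_of_abs_le_one {x : ℝ} (hx : |x| ≤ 1) : tent x = 1 - |x| :=
  max_eq_left (by linarith)

lemma integrable_tent : Integrable tent := by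
  refine continuous_tent.integrable_of_hasCompactSupport
    (HasCompactSupport.intro (isCompact_Icc (a := (-1 : ℝ)) (b := 1)) fun x hx => ?_)
  refine tent_of_one_le_abs ?_
  by_contra! h
  exact hx (abs_le.1 h.le)

lemma tent_mul_abs_le (x : ℝ) : tent x * |x| ≤ tent x := by
  rcases le_total |x| 1 with h | h
  · exact mul_le_of_le_one_right (tent_nonneg x) h
  · simp [tent_of_one_le_abs h]

lemma ae_ne_zero : ∀ᵐ x : ℝ, x ≠ 0 := Measure.ae_ne volume 0

lemma gfun_eq_tent_mul {x : ℝ} (hx : x ≠ 0) (τ : ℝ) :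
    gfun τ x = tent x *
      ((cos (2 * π * τ * x) - cos (2 * π * (τ + 1) * x)) / (2 * π ^ 2 * x ^ 2)) := by
  rw [gfun, if_neg hx]
  split_ifs with h
  · rw [tent_of_abs_le_one h]
    field_simp
    ring
  · rw [tent_of_one_le_abs (not_le.1 h).le, zero_mul]

lemma measurable_gfun (τ : ℝ) : Measurable (gfun τ) := by
  unfold gfun
  refine Measurable.ite (measurableSet_singleton 0) measurable_const
    (Measurable.ite (measurableSet_le (by fun_prop) measurable_const) (by fun_prop)
      measurable_const)

lemma abs_gfun_le {x : ℝ} (hx : x ≠ 0) (τ : ℝ) : |gfun τ x| ≤ |2 * τ + 1| * tent x := by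
  rw [gfun_eq_tent_mul hx, abs_mul, abs_of_nonneg (tent_nonneg x), mul_comm]
  refine mul_le_mul_of_nonneg_right ?_ (tent_nonneg x)
  rw [abs_div, abs_of_pos (by positivity : 0 < 2 * π ^ 2 * x ^ 2), div_le_iff₀ (by positivity),
    cos_sub_cos, abs_mul, abs_mul]
  have h₁ := abs_sin_le_abs (x := (2 * π * τ * x + 2 * π * (τ + 1) * x) / 2)
  have h₂ := abs_sin_le_abs (x := (2 * π * τ * x - 2 * π * (τ + 1) * x) / 2)
  have e₁ : |(2 * π * τ * x + 2 * π * (τ + 1) * x) / 2| = π * |2 * τ + 1| * |x| := by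
    rw [show (2 * π * τ * x + 2 * π * (τ + 1) * x) / 2 = π * (2 * τ + 1) * x by ring, abs_mul,
      abs_mul, abs_of_pos pi_pos]
  have e₂ : |(2 * π * τ * x - 2 * π * (τ + 1) * x) / 2| = π * |x| := by
    rw [show (2 * π * τ * x - 2 * π * (τ + 1) * x) / 2 = -(π * x) by ring, abs_neg, abs_mul,
      abs_of_pos pi_pos]
  rw [e₁] at h₁
  rw [e₂] at h₂
  have h := mul_le_mul h₁ h₂ (abs_nonneg _) (by positivity)
  rw [← sq_abs x, abs_neg, abs_two]
  nlinarith [h]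

lemma integrable_gfun_mul_cos (τ t : ℝ) :
    Integrable fun x => gfun τ x * cos (2 * π * x * t) := by
  refine (integrable_tent.const_mul |2 * τ + 1|).mono'
    ((measurable_gfun τ).mul (by fun_prop)).aestronglyMeasurable ?_
  filter_upwards [ae_ne_zero] with x hx
  rw [norm_mul, norm_eq_abs, norm_eq_abs]
  exact (mul_le_of_le_one_right (abs_nonneg _) (abs_cos_le_one _)).trans (abs_gfun_le hx τ)

lemma hasDerivAt_ghat_freq (τ t : ℝ) :
    (Integrable fun x => gfun τ x * (-sin (2 * π * x * t) * (2 * π * x))) ∧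
      HasDerivAt (fun s => ghat τ s)
        (∫ x, gfun τ x * (-sin (2 * π * x * t) * (2 * π * x))) t := by
  refine hasDerivAt_integral_of_dominated_loc_of_deriv_le (s := univ)
    (F' := fun s x => gfun τ x * (-sin (2 * π * x * s) * (2 * π * x)))
    (bound := fun x => |2 * τ + 1| * (2 * π) * tent x) univ_mem
    (.of_forall fun s => (integrable_gfun_mul_cos τ s).aestronglyMeasurable)
    (integrable_gfun_mul_cos τ t)
    ((measurable_gfun τ).mul (by fun_prop)).aestronglyMeasurable ?_
    (integrable_tent.const_mul _) ?_
  · filter_upwards [ae_ne_zero] with x hx s _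
    have h₁ : |-sin (2 * π * x * s) * (2 * π * x)| ≤ 2 * π * |x| := by
      rw [abs_mul, abs_neg, abs_mul (2 * π), abs_of_pos two_pi_pos]
      exact mul_le_of_le_one_left (by positivity) (abs_sin_le_one _)
    calc ‖gfun τ x * (-sin (2 * π * x * s) * (2 * π * x))‖
        = |gfun τ x| * |-sin (2 * π * x * s) * (2 * π * x)| := by rw [norm_eq_abs, abs_mul]
      _ ≤ (|2 * τ + 1| * tent x) * (2 * π * |x|) :=
        mul_le_mul (abs_gfun_le hx τ) h₁ (abs_nonneg _)
          (mul_nonneg (abs_nonneg _) (tent_nonneg x))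
      _ = |2 * τ + 1| * (2 * π) * (tent x * |x|) := by ring
      _ ≤ |2 * τ + 1| * (2 * π) * tent x :=
        mul_le_mul_of_nonneg_left (tent_mul_abs_le x) (by positivity)
  · refine .of_forall fun x s _ => HasDerivAt.const_mul _ ?_
    simpa using ((hasDerivAt_id s).const_mul (2 * π * x)).cos

lemma hasDerivAt_ghat_param (τ t : ℝ) :
    (Integrable fun x => tent x *
      ((sin (2 * π * (τ + 1) * x) - sin (2 * π * τ * x)) / (π * x)) * cos (2 * π * x * t)) ∧
      HasDerivAt (fun σ => ghat σ t)
        (∫ x, tent x * ((sin (2 * π * (τ + 1) * x) - sin (2 * π * τ * x)) / (π * x)) *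
          cos (2 * π * x * t)) τ := by
  refine hasDerivAt_integral_of_dominated_loc_of_deriv_le (s := univ)
    (F' := fun σ x => tent x * ((sin (2 * π * (σ + 1) * x) - sin (2 * π * σ * x)) / (π * x)) *
      cos (2 * π * x * t))
    (bound := fun x => 2 * tent x) univ_mem
    (.of_forall fun σ => (integrable_gfun_mul_cos σ t).aestronglyMeasurable)
    (integrable_gfun_mul_cos τ t)
    ((continuous_tent.measurable.mul (by fun_prop)).mul (by fun_prop)).aestronglyMeasurable ?_
    (integrable_tent.const_mul _) ?_
  · filter_upwards [ae_ne_zero] with x hx σ _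
    have h₁ : |(sin (2 * π * (σ + 1) * x) - sin (2 * π * σ * x)) / (π * x)| ≤ 2 := by
      rw [abs_div, div_le_iff₀ (by positivity)]
      refine (abs_sin_sub_sin_le _ _).trans_eq ?_
      rw [show 2 * π * (σ + 1) * x - 2 * π * σ * x = 2 * (π * x) by ring, abs_mul, abs_two]
    calc ‖tent x * ((sin (2 * π * (σ + 1) * x) - sin (2 * π * σ * x)) / (π * x)) *
          cos (2 * π * x * t)‖
        = tent x * |(sin (2 * π * (σ + 1) * x) - sin (2 * π * σ * x)) / (π * x)| *
          |cos (2 * π * x * t)| := by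
          rw [norm_eq_abs, abs_mul, abs_mul, abs_of_nonneg (tent_nonneg x)]
      _ ≤ tent x * 2 * 1 := by
        have := tent_nonneg x
        have := abs_cos_le_one (2 * π * x * t)
        gcongr
      _ = 2 * tent x := by ring
  · filter_upwards [ae_ne_zero] with x hx σ _
    refine HasDerivAt.mul_const ?_ _
    simp only [gfun_eq_tent_mul hx]
    refine HasDerivAt.const_mul _ ?_
    have h₁ := (((hasDerivAt_id σ).const_mul (2 * π)).mul_const x).cos
    have h₂ := ((((hasDerivAt_id σ).add_const 1).const_mul (2 * π)).mul_const x).cos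
    refine ((h₁.sub h₂).div_const (2 * π ^ 2 * x ^ 2)).congr_deriv ?_
    simp only [id]
    field_simp
    ring

lemma integral_two_mul_cos {x : ℝ} (hx : x ≠ 0) (a b : ℝ) :
    ∫ v in a..b, 2 * cos (2 * π * v * x) =
      (sin (2 * π * b * x) - sin (2 * π * a * x)) / (π * x) := by
  have h (v : ℝ) : HasDerivAt (fun v => sin (2 * π * v * x) / (π * x))
      (2 * cos (2 * π * v * x)) v := by
    refine (((((hasDerivAt_id v).const_mul (2 * π)).mul_const x).sin).div_const
      (π * x)).congr_deriv ?_
    simp only [id]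
    field_simp
  rw [intervalIntegral.integral_eq_sub_of_hasDerivAt (fun v _ => h v)
    (Continuous.intervalIntegrable (by fun_prop) _ _)]
  ring

lemma integral_tent_mul_cos {v : ℝ} (hv : v ≠ 0) :
    ∫ x, tent x * (2 * cos (2 * π * v * x)) = 2 * (sin (π * v) ^ 2 / (π * v) ^ 2) := by
  have h_abs (x : ℝ) : tent x * (2 * cos (2 * π * v * x)) =
      (fun y => tent y * (2 * cos (2 * π * v * y))) |x| := by
    rcases abs_cases x with h | h <;> simp [tent, h.1]
  rw [integral_congr_ae (.of_forall h_abs),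
    integral_comp_abs (f := fun y => tent y * (2 * cos (2 * π * v * y)))]
  have h_Ioc : ∫ x in Ioi (0 : ℝ), tent x * (2 * cos (2 * π * v * x)) =
      ∫ x in Ioc (0 : ℝ) 1, tent x * (2 * cos (2 * π * v * x)) := by
    refine setIntegral_eq_of_subset_of_forall_sdiff_eq_zero measurableSet_Ioi
      Ioc_subset_Ioi_self fun x hx => ?_
    have h₀ : 0 < x := hx.1
    have h₁ : 1 ≤ |x| := by
      rw [abs_of_pos h₀]
      by_contra! h
      exact hx.2 ⟨h₀, h.le⟩
    rw [tent_of_one_le_abs h₁, zero_mul]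
  have h_deriv (x : ℝ) : HasDerivAt
      (fun x => (1 - x) * sin (2 * π * v * x) / (π * v) -
        cos (2 * π * v * x) / (2 * (π * v) ^ 2)) ((1 - x) * (2 * cos (2 * π * v * x))) x := by
    have h := (hasDerivAt_id x).const_mul (2 * π * v)
    refine (((((hasDerivAt_id x).const_sub 1).mul h.sin).div_const (π * v)).sub
      (h.cos.div_const (2 * (π * v) ^ 2))).congr_deriv ?_
    simp only [id]
    field_simp
    ring
  rw [h_Ioc, ← intervalIntegral.integral_of_le zero_le_one,
    intervalIntegral.integral_congr (g := fun x => (1 - x) * (2 * cos (2 * π * v * x))),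
    intervalIntegral.integral_eq_sub_of_hasDerivAt (fun x _ => h_deriv x)
      (Continuous.intervalIntegrable (by fun_prop) _ _)]
  · have h_sq := sin_sq_eq_half_sub (π * v)
    rw [h_sq, show 2 * π * v * 1 = 2 * (π * v) by ring]
    simp
    field_simp
    ring
  · intro x hx
    rw [uIcc_of_le zero_le_one] at hx
    have : |x| = x := abs_of_nonneg hx.1
    simp only [tent_of_abs_le_one (this.trans_le hx.2), this]

lemma integral_tent_mul_intervalIntegral_cos (a b : ℝ) :
    ∫ x, tent x * ∫ v in a..b, 2 * cos (2 * π * v * x) =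
      ∫ v in a..b, 2 * (sin (π * v) ^ 2 / (π * v) ^ 2) := by
  have h_int : Integrable (Function.uncurry fun v x : ℝ => tent x * (2 * cos (2 * π * v * x)))
      ((volume.restrict (uIoc a b)).prod volume) := by
    have : IsFiniteMeasure (volume.restrict (uIoc a b)) :=
      isFiniteMeasure_restrict_Ioc _ _
    have h := (integrable_const (μ := volume.restrict (uIoc a b)) (2 : ℝ)).mul_prod
      integrable_tent
    refine h.mono' ?_ (.of_forall fun p => ?_)
    · have := continuous_tent
      refine Continuous.aestronglyMeasurable ?_
      unfold Function.uncurry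
      fun_prop
    · have := mul_le_mul_of_nonneg_left (abs_cos_le_one (2 * π * p.1 * p.2)) (tent_nonneg p.2)
      rw [Function.uncurry, norm_eq_abs, abs_mul, abs_mul, abs_two,
        abs_of_nonneg (tent_nonneg _)]
      linarith
  simp_rw [← intervalIntegral.integral_const_mul]
  rw [← intervalIntegral_integral_swap h_int]
  refine intervalIntegral.integral_congr_ae ?_
  filter_upwards [ae_ne_zero] with v hv _ using integral_tent_mul_cos hv

theorem sum_of_first_partials (t τ : ℝ) (hτ : 0 ≤ τ) :
    deriv (fun s => ghat τ s) t + deriv (fun σ => ghat σ t) τ =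
      (2 / π) * ∫ u in (π * (t + τ))..(π * (t + τ + 1)), Real.sin u ^ 2 / u ^ 2 := by
  obtain ⟨hi₁, hd₁⟩ := hasDerivAt_ghat_freq τ t
  obtain ⟨hi₂, hd₂⟩ := hasDerivAt_ghat_param τ t
  rw [hd₁.deriv, hd₂.deriv, ← integral_add hi₁ hi₂,
    integral_congr_ae (g := fun x => tent x *
      ∫ v in (t + τ)..(t + τ + 1), 2 * cos (2 * π * v * x)),
    integral_tent_mul_intervalIntegral_cos, intervalIntegral.integral_const_mul,
    intervalIntegral.integral_comp_mul_left (fun u => sin u ^ 2 / u ^ 2) pi_ne_zero, smul_eq_mul]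
  · ring
  · filter_upwards [ae_ne_zero] with x hx
    rw [integral_two_mul_cos hx, gfun_eq_tent_mul hx,
      show 2 * π * (t + τ + 1) * x = 2 * π * (τ + 1) * x + 2 * π * x * t by ring,
      show 2 * π * (t + τ) * x = 2 * π * τ * x + 2 * π * x * t by ring, sin_add, sin_add]
    field_simp
    ring
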